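/- Let a > 0, b > 0, σ > 0, κ > 0, and let ν be a measure on (0,∞) with ∫_0^∞ (z∧1) ν(dz) < ∞ and ∫_{(1,∞)} z^κ ν(dz) < ∞. Let (μ_{t,x})_{t≥0, x≥0} be a family of probability measures on [0,∞) such that for all t ≥ 0, x ≥ 0 and all real u ≤ 0, ∫ e^{uy} μ_{t,x}(dy) = (1 − (σ²u/(2b))(1 − e^{−bt}))^{−2a/σ²} · exp(x ψ(t,u)) · exp(∫_0^t ∫_0^∞ (e^{zψ(s,u)} − 1) ν(dz) ds). Then there exist a probability measure π on [0,∞), a constant δ > 0 and a finite-valued function B : [0,∞) → [0,∞) such that ‖μ_{t,x} − π‖_TV ≤ B(x) e^{−δt} for all x ≥ 0 and t > 0. (This is the exponential ergodicity of the jump-diffusion CIR process: μ_{t,x} is its transition probability P^t(x,·).) -/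

import Mathlib

open MeasureTheory Filter Set
open scoped ENNReal

/-- `ψ(t,u) = u e^{−bt} / (1 − (σ²u/(2b))(1 − e^{−bt}))`. -/
noncomputable def psi (b σ t u : ℝ) : ℝ :=
  u * Real.exp (-b * t) / (1 - σ ^ 2 * u / (2 * b) * (1 - Real.exp (-b * t)))

/-- The total variation norm `‖μ − π‖_TV` of the difference of two (finite) measures,
expressed via the Jordan decomposition `(μ − π)(univ) + (π − μ)(univ)`
(using truncated subtraction of measures). -/
noncomputable def tvDist (μ π : Measure ℝ) : ℝ≥0∞ :=
  (μ - π) Set.univ + (π - μ) Set.univ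

noncomputable def lapl (μ : Measure ℝ) (u : ℝ) : ℝ≥0∞ := ∫⁻ y, ENNReal.ofReal (Real.exp (u * y)) ∂μ

lemma charFun_hasSum (μ : Measure ℝ) [IsFiniteMeasure μ] (hμ : ∀ᵐ y ∂μ, 0 ≤ y) (t : ℝ) :
    HasSum (fun n : ℕ => ((t * Complex.I) ^ n / (n.factorial : ℂ)) *
      (((lapl μ (-(n:ℝ))).toReal : ℝ) : ℂ)) (charFun (μ.map (fun y => Real.exp (-y))) t) := by
  have hF : ∀ n : ℕ, ∫ y, ((t * Complex.I) ^ n / (n.factorial : ℂ)) *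
      ((Real.exp (-(n:ℝ) * y) : ℝ) : ℂ) ∂μ = ((t * Complex.I) ^ n / (n.factorial : ℂ)) *
      (((lapl μ (-(n:ℝ))).toReal : ℝ) : ℂ) := by
    intro n
    rw [integral_const_mul, integral_complex_ofReal, integral_eq_lintegral_of_nonneg_ae]
    · rfl
    · exact Eventually.of_forall fun y => (Real.exp_pos _).le
    · fun_prop
  rw [charFun_apply_real, integral_map (by fun_prop) (by fun_prop)]
  simp_rw [← hF]
  have hs : Summable fun n : ℕ => |t| ^ n / (n.factorial : ℝ) := Real.summable_pow_div_factorial _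
  refine hasSum_integral_of_dominated_convergence (fun n _ => |t| ^ n / (n.factorial : ℝ))
    (fun n => by fun_prop) ?_ (Eventually.of_forall fun _ => hs) (integrable_const _) ?_
  · intro n
    filter_upwards [hμ] with y hy
    rw [norm_mul, norm_div, norm_pow, norm_mul, Complex.norm_I, mul_one, Complex.norm_real,
      Complex.norm_natCast, Complex.norm_real, Real.norm_eq_abs, Real.norm_eq_abs,
      abs_of_pos (Real.exp_pos _)]
    apply mul_le_of_le_one_right (by positivity)
    rw [Real.exp_le_one_iff]
    nlinarith [mul_nonneg (Nat.cast_nonneg (α := ℝ) n) hy]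
  · refine Eventually.of_forall fun y => ?_
    have h := NormedSpace.expSeries_div_hasSum_exp ((t : ℂ) * (Real.exp (-y) : ℝ) * Complex.I)
    rw [← Complex.exp_eq_exp_ℂ] at h
    have e : (fun n : ℕ => ((t * Complex.I) ^ n / (n.factorial : ℂ)) *
        ((Real.exp (-(n:ℝ) * y) : ℝ) : ℂ)) = fun n : ℕ =>
        ((t : ℂ) * (Real.exp (-y) : ℝ) * Complex.I) ^ n / (n.factorial : ℂ) := by
     funext n
     rw [show -(n:ℝ) * y = n * (-y) by ring, Real.exp_nat_mul]
     push_cast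
     ring
    rw [e]
    exact h

lemma lapl_ext (μ ν : Measure ℝ) [IsFiniteMeasure μ] [IsFiniteMeasure ν]
    (hμ : ∀ᵐ y ∂μ, 0 ≤ y) (hν : ∀ᵐ y ∂ν, 0 ≤ y) (h : ∀ u ≤ 0, lapl μ u = lapl ν u) : μ = ν := by
  have key : μ.map (fun y => Real.exp (-y)) = ν.map (fun y => Real.exp (-y)) := by
    apply Measure.ext_of_charFun
    ext t
    have h1 := charFun_hasSum μ hμ t
    have h2 := charFun_hasSum ν hν t
    simp_rw [fun n : ℕ => h (-(n:ℝ)) (by simp)] at h1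
    exact h1.unique h2
  have h3 := congrArg (Measure.map (fun x => -Real.log x)) key
  rw [Measure.map_map (by fun_prop) (by fun_prop), Measure.map_map (by fun_prop) (by fun_prop)] at h3
  have : ((fun x => -Real.log x) ∘ fun y => Real.exp (-y)) = id := by
    ext y; simp
  simpa [this] using h3

noncomputable def expM (θ : ℝ) : Measure ℝ :=
  (volume.restrict (Ioi (0:ℝ))).withDensity (fun y => ENNReal.ofReal (1/θ * Real.exp (-(1/θ) * y)))

lemma lapl_expM (θ : ℝ) (hθ : 0 < θ) (u : ℝ) (hu : u ≤ 0) :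
    lapl (expM θ) u = ENNReal.ofReal (1 / (1 - θ * u)) := by
  unfold lapl expM
  rw [lintegral_withDensity_eq_lintegral_mul _ (by fun_prop) (by fun_prop)]
  have hneg : u - 1/θ < 0 := by have : 0 < 1/θ := by positivity
                                linarith
  have h1 : ∀ y : ℝ, ((fun y => ENNReal.ofReal (1/θ * Real.exp (-(1/θ) * y))) *
      fun y => ENNReal.ofReal (Real.exp (u * y))) y =
      ENNReal.ofReal (1/θ * Real.exp ((u - 1/θ) * y)) := by
    intro y
    simp only [Pi.mul_apply]
    rw [← ENNReal.ofReal_mul (by positivity), mul_assoc, ← Real.exp_add]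
    congr 3; ring
  simp_rw [h1]
  rw [← ofReal_integral_eq_lintegral_ofReal]
  · rw [integral_const_mul, integral_exp_mul_Ioi hneg]
    congr 1
    have : 1 - θ * u ≠ 0 := by nlinarith
    simp only [mul_zero, Real.exp_zero]
    have h2 : u - 1/θ = -(1 - θ * u)/θ := by field_simp; ring
    rw [h2]; field_simp
  · exact (integrableOn_exp_mul_Ioi hneg 0).const_mul _
  · exact Eventually.of_forall fun y => by positivity


lemma isFin_expM (θ : ℝ) (hθ : 0 < θ) : IsFiniteMeasure (expM θ) := by
  have := lapl_expM θ hθ 0 le_rfl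
  constructor
  simp [lapl] at this
  simp [this]

lemma expM_nonneg (θ : ℝ) : ∀ᵐ y ∂(expM θ), 0 ≤ y := by
  refine (withDensity_absolutelyContinuous _ _).ae_le ?_
  filter_upwards [ae_restrict_mem measurableSet_Ioi] with y hy using le_of_lt hy

lemma lapl_conv (μ ν : Measure ℝ) [SFinite ν] (u : ℝ) :
    lapl (μ.conv ν) u = lapl μ u * lapl ν u := by
  unfold lapl
  rw [Measure.lintegral_conv (by fun_prop)]
  rw [← lintegral_mul_const _ (by fun_prop)]
  refine lintegral_congr fun x => ?_
  rw [← lintegral_const_mul _ (by fun_prop)]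
  refine lintegral_congr fun y => ?_
  rw [← ENNReal.ofReal_mul (by positivity), ← Real.exp_add, mul_add]

lemma conv_nonneg (μ ν : Measure ℝ) [SFinite μ] [SFinite ν] (hμ : ∀ᵐ y ∂μ, 0 ≤ y)
    (hν : ∀ᵐ y ∂ν, 0 ≤ y) : ∀ᵐ y ∂(μ.conv ν), 0 ≤ y := by
  unfold Measure.conv
  rw [ae_map_iff (by fun_prop) measurableSet_Ici]
  have h1 : ∀ᵐ z ∂(μ.prod ν), 0 ≤ z.1 := Measure.quasiMeasurePreserving_fst.ae hμ
  have h2 : ∀ᵐ z ∂(μ.prod ν), 0 ≤ z.2 := Measure.quasiMeasurePreserving_snd.ae hν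
  filter_upwards [h1, h2] with z a b using add_nonneg a b

noncomputable def Rn (P E : Measure ℝ) : ℕ → Measure ℝ
  | 0 => P
  | n+1 => (Rn P E n).conv E

lemma isFin_Rn (P E : Measure ℝ) [IsFiniteMeasure P] [IsFiniteMeasure E] (n : ℕ) :
    IsFiniteMeasure (Rn P E n) := by
  induction n with
  | zero => assumption
  | succ n ih => exact Measure.finite_of_finite_conv _ _

lemma Rn_nonneg (P E : Measure ℝ) [IsFiniteMeasure P] [IsFiniteMeasure E] (hP : ∀ᵐ y ∂P, 0 ≤ y)
    (hE : ∀ᵐ y ∂E, 0 ≤ y) (n : ℕ) : ∀ᵐ y ∂(Rn P E n), 0 ≤ y := by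
  induction n with
  | zero => assumption
  | succ n ih =>
    have := isFin_Rn P E n
    exact conv_nonneg _ _ ih hE

lemma lapl_Rn (P E : Measure ℝ) [IsFiniteMeasure P] [IsFiniteMeasure E] (u : ℝ) (n : ℕ) :
    lapl (Rn P E n) u = lapl P u * lapl E u ^ n := by
  induction n with
  | zero => simp [Rn]
  | succ n ih => rw [Rn, lapl_conv, ih, pow_succ, mul_assoc]

lemma domination (P Q M : Measure ℝ) [IsFiniteMeasure P] [IsFiniteMeasure M]
    (hP : ∀ᵐ y ∂P, 0 ≤ y) (hQ : ∀ᵐ y ∂Q, 0 ≤ y) (hM : ∀ᵐ y ∂M, 0 ≤ y)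
    (l θ : ℝ) (hl : 0 < l) (hθ : 0 < θ)
    (h : ∀ u ≤ 0, lapl M u = lapl P u * lapl Q (l * (1 / (1 - θ * u) - 1))) :
    lapl Q (-l) • P ≤ M := by
  have := isFin_expM θ hθ
  set q : ℕ → ℝ≥0∞ := fun n => ∫⁻ y, ENNReal.ofReal (Real.exp (-l * y)) *
    ENNReal.ofReal ((l * y) ^ n / n.factorial) ∂Q with hq
  have hq0 : q 0 = lapl Q (-l) := by simp [hq, lapl]
  set N : Measure ℝ := Measure.sum (fun n => q n • Rn P (expM θ) n) with hN
  have hsum : ∀ u ≤ 0, ∑' n, q n * (ENNReal.ofReal (1 / (1 - θ * u))) ^ n =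
      lapl Q (l * (1 / (1 - θ * u) - 1)) := by
    intro u hu
    have hpos : 0 < 1 - θ * u := by nlinarith
    have e0 : ∀ n : ℕ, q n * (ENNReal.ofReal (1 / (1 - θ * u))) ^ n =
        ∫⁻ y, ENNReal.ofReal (Real.exp (-l * y)) * ENNReal.ofReal ((l * y) ^ n / n.factorial) *
          (ENNReal.ofReal (1 / (1 - θ * u))) ^ n ∂Q := fun n => by
      rw [lintegral_mul_const _ (by fun_prop)]
    simp_rw [e0]
    rw [← lintegral_tsum (fun n => by fun_prop)]
    unfold lapl
    apply lintegral_congr_ae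
    filter_upwards [hQ] with y hy
    have hg : 0 ≤ 1 / (1 - θ * u) := by positivity
    have e1 : ∀ n : ℕ, ENNReal.ofReal (Real.exp (-l * y)) * ENNReal.ofReal ((l * y) ^ n / n.factorial)
        * ENNReal.ofReal (1 / (1 - θ * u)) ^ n = ENNReal.ofReal (Real.exp (-l * y) *
          ((l * y * (1 / (1 - θ * u))) ^ n / n.factorial)) := by
      intro n
      rw [← ENNReal.ofReal_pow hg, ← ENNReal.ofReal_mul (by positivity),
        ← ENNReal.ofReal_mul (by positivity)]
      congr 1; ring
    simp_rw [e1]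
    have hs := (NormedSpace.expSeries_div_hasSum_exp (l * y * (1 / (1 - θ * u)))).mul_left
      (Real.exp (-l * y))
    rw [← ENNReal.ofReal_tsum_of_nonneg (fun n => by positivity) hs.summable, hs.tsum_eq,
      ← Real.exp_eq_exp_ℝ, ← Real.exp_add]
    congr 2; ring
  have hNl : ∀ u ≤ 0, lapl N u = lapl M u := by
    intro u hu
    rw [h u hu, ← hsum u hu, ← ENNReal.tsum_mul_left, lapl, hN, lintegral_sum_measure]
    congr 1; ext n
    rw [lintegral_smul_measure]
    have := lapl_Rn P (expM θ) u n
    rw [lapl_expM θ hθ u hu] at this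
    unfold lapl at this ⊢
    rw [this, smul_eq_mul]; ring
  have hNf : IsFiniteMeasure N := by
    constructor
    have := hNl 0 le_rfl
    simp only [lapl, zero_mul, Real.exp_zero, ENNReal.ofReal_one, lintegral_one] at this
    rw [this]; exact measure_lt_top _ _
  have hNn : ∀ᵐ y ∂N, 0 ≤ y := by
    rw [hN, Measure.ae_sum_iff]
    intro n
    exact Measure.smul_absolutelyContinuous.ae_le (Rn_nonneg P _ hP (expM_nonneg θ) n)
  rw [← lapl_ext N M hNn hM hNl, ← hq0]
  exact Measure.le_sum (fun n => q n • Rn P (expM θ) n) 0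
lemma exists_sup (m : ℕ → Measure ℝ) (hm : Monotone m) :
    ∃ π : Measure ℝ, ∀ s, MeasurableSet s → π s = ⨆ n, m n s := by
  refine ⟨Measure.ofMeasurable (fun s _ => ⨆ n, m n s) (by simp) ?_, fun s hs =>
    Measure.ofMeasurable_apply s hs⟩
  intro f hf hd
  simp_rw [measure_iUnion hd hf, ENNReal.tsum_eq_iSup_sum]
  rw [iSup_comm]
  refine iSup_congr fun s => ?_
  rw [ENNReal.finsetSum_iSup_of_monotone]
  intro i a b hab
  exact hm hab _

lemma tv_le (μ π η : Measure ℝ) [IsProbabilityMeasure μ] [IsProbabilityMeasure π]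
    [IsFiniteMeasure η] (h1 : η ≤ μ) (h2 : η ≤ π) : tvDist μ π ≤ 2 * (1 - η univ) := by
  have key : ∀ μ π : Measure ℝ, IsProbabilityMeasure μ → η ≤ μ → η ≤ π →
      (μ - π) univ ≤ 1 - η univ := by
    intro μ π _ h1 h2
    have : μ - π ≤ μ - η := by
      apply Measure.sub_le_of_le_add
      calc μ = μ - η + η := (Measure.sub_add_cancel_of_le h1).symm
        _ ≤ _ := by gcongr
    calc (μ - π) univ ≤ (μ - η) univ := this _
      _ = _ := by rw [Measure.sub_apply MeasurableSet.univ h1, measure_univ]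
  unfold tvDist
  rw [two_mul]
  exact add_le_add (key μ π inferInstance h1 h2) (key π μ inferInstance h2 h1)

lemma exists_limit (m : ℝ → Measure ℝ) (hm : ∀ t, 1 ≤ t → IsProbabilityMeasure (m t))
    (D δ : ℝ) (hδ : 0 < δ)
    (h : ∀ s r, 1 ≤ s → 0 ≤ r →
      ENNReal.ofReal (Real.exp (-(D * Real.exp (-δ * s)))) • m s ≤ m (s + r)) :
    ∃ π : Measure ℝ, IsProbabilityMeasure π ∧ ∀ s, 1 ≤ s →
      ENNReal.ofReal (Real.exp (-(D * Real.exp (-δ * s)))) • m s ≤ π := by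
  have h1 : 0 < 1 - Real.exp (-δ) := by
    have : Real.exp (-δ) < 1 := Real.exp_lt_one_iff.2 (by linarith)
    linarith
  set D' := D / (1 - Real.exp (-δ)) with hD'
  have hD : D' * (1 - Real.exp (-δ)) = D := by rw [hD']; field_simp
  set c : ℕ → ℝ≥0∞ := fun n => ENNReal.ofReal (Real.exp (-(D' * Real.exp (-δ * (n + 1))))) with hc
  set N : ℕ → Measure ℝ := fun n => c n • m (n + 1) with hN
  have hmono : Monotone N := by
    apply monotone_nat_of_le_succ
    intro n
    simp only [hN]
    have e : c n = c (n + 1) *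
        ENNReal.ofReal (Real.exp (-(D * Real.exp (-δ * ((n:ℝ) + 1))))) := by
      simp only [hc]
      rw [← ENNReal.ofReal_mul (by positivity), ← Real.exp_add, ← hD]
      congr 2
      push_cast
      rw [show -δ * ((n:ℝ) + 1 + 1) = -δ + -δ * (n + 1) by ring, Real.exp_add (-δ)]
      ring
    rw [e, mul_smul]
    have := h ((n:ℝ) + 1) 1 (by have := Nat.cast_nonneg (α := ℝ) n; linarith) zero_le_one
    push_cast
    gcongr
  have hct : Tendsto c atTop (nhds 1) := by
    have : Tendsto (fun n : ℕ => -δ * ((n:ℝ) + 1)) atTop atBot :=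
      (tendsto_natCast_atTop_atTop.atTop_add tendsto_const_nhds).const_mul_atTop_of_neg (by linarith)
    have h2 := (Real.tendsto_exp_atBot.comp this).const_mul D'
    have h3 := (Real.continuous_exp.tendsto _).comp h2.neg
    have h4 := (ENNReal.continuous_ofReal.tendsto _).comp h3
    simpa [hc, Function.comp_def] using h4
  obtain ⟨π, hπ⟩ := exists_sup N hmono
  have hle : ∀ n, N n ≤ π := by
    intro n
    rw [Measure.le_iff]
    intro s hs
    rw [hπ s hs]
    exact le_iSup (fun n => N n s) n
  refine ⟨π, ⟨?_⟩, ?_⟩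
  · rw [hπ _ MeasurableSet.univ]
    have e : (fun n => N n univ) = c := by
      ext n
      have := hm ((n:ℝ) + 1) (by have := Nat.cast_nonneg (α := ℝ) n; linarith)
      simp [hN]
    have hmon : Monotone (fun n => N n univ) := fun a b hab => hmono hab _
    exact tendsto_nhds_unique (tendsto_atTop_iSup hmon) (by rw [e]; exact hct)
  · intro s hs
    rw [Measure.le_iff]
    intro A hA
    set d := ENNReal.ofReal (Real.exp (-(D * Real.exp (-δ * s))))
    have h5 : ∀ᶠ n in atTop, c n * (d • m s) A ≤ π A := by
      filter_upwards [eventually_ge_atTop ⌈s⌉₊] with n hn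
      have hsn : s ≤ n := (Nat.le_ceil s).trans (by exact_mod_cast hn)
      have := h s ((n:ℝ) + 1 - s) hs (by linarith)
      rw [add_sub_cancel] at this
      calc c n * (d • m s) A ≤ c n * m (n + 1) A := by gcongr
        _ = N n A := by simp [hN]
        _ ≤ π A := hle n A
    have h6 : Tendsto (fun n => c n * (d • m s) A) atTop (nhds (1 * (d • m s) A)) :=
      ENNReal.Tendsto.mul_const hct (Or.inl one_ne_zero)
    rw [one_mul] at h6
    exact le_of_tendsto h6 h5
lemma F_props (ν : Measure ℝ) (κ : ℝ) (hκ : 0 < κ)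
    (hν : ∫⁻ z in Set.Ioi (0 : ℝ), ENNReal.ofReal (min z 1) ∂ν < ⊤)
    (hνκ : ∫⁻ z in Set.Ioi (1 : ℝ), ENNReal.ofReal (z ^ κ) ∂ν < ⊤) :
    ∃ C k : ℝ, 0 ≤ C ∧ 0 < k ∧ k ≤ 1 ∧ ∀ v ≤ 0,
      IntegrableOn (fun z => Real.exp (z * v) - 1) (Ioi 0) ν ∧
      -(C * ((-v) ^ k + (-v))) ≤ ∫ z in Ioi (0:ℝ), (Real.exp (z * v) - 1) ∂ν := by
  set k := min κ 1 with hk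
  have hk0 : 0 < k := lt_min hκ one_pos
  have hk1 : k ≤ 1 := min_le_right _ _
  have hkκ : k ≤ κ := min_le_left _ _
  set W : ℝ → ℝ := fun z => min z 1 + (Ioi (1:ℝ)).indicator (fun z => z ^ κ) z with hW
  have hmκ : Measurable fun z : ℝ => z ^ κ := by fun_prop
  have hWi : IntegrableOn W (Ioi 0) ν := by
    apply Integrable.add
    · refine ⟨by fun_prop, ?_⟩
      rw [hasFiniteIntegral_iff_ofReal]
      · exact hν
      · filter_upwards [ae_restrict_mem measurableSet_Ioi] with z hz
        exact le_min (le_of_lt hz) zero_le_one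
    · have : IntegrableOn (fun z : ℝ => z ^ κ) (Ioi 1) ν := by
        refine ⟨hmκ.aestronglyMeasurable, ?_⟩
        rw [hasFiniteIntegral_iff_ofReal]
        · exact hνκ
        · filter_upwards [ae_restrict_mem measurableSet_Ioi] with z hz
          exact Real.rpow_nonneg (zero_le_one.trans (le_of_lt hz)) _
      exact (this.integrable_indicator measurableSet_Ioi).integrableOn
  have hW0 : ∀ z, 0 < z → 0 ≤ W z := by
    intro z hz
    apply add_nonneg (le_min hz.le zero_le_one)
    apply indicator_nonneg
    intro y hy
    exact Real.rpow_nonneg (zero_le_one.trans (le_of_lt hy)) _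
  have hb : ∀ z v : ℝ, 0 < z → v ≤ 0 → 1 - Real.exp (z * v) ≤ ((-v) ^ k + (-v)) * W z := by
    intro z v hz hv
    have e1 : 1 - Real.exp (z * v) ≤ z * (-v) := by
      have := Real.add_one_le_exp (z * v); linarith
    have e2 : 1 - Real.exp (z * v) ≤ 1 := by have := Real.exp_pos (z * v); linarith
    have hvk : 0 ≤ (-v) ^ k := Real.rpow_nonneg (by linarith) _
    rcases le_or_gt z 1 with h | h
    · have : W z = z := by simp [hW, h]
      rw [this]; nlinarith
    · have hWz : W z = 1 + z ^ κ := by simp [hW, h, h.le]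
      have hx : 0 ≤ z * (-v) := mul_nonneg hz.le (by linarith)
      have e3 : 1 - Real.exp (z * v) ≤ (z * (-v)) ^ k := by
        rcases le_or_gt (z * (-v)) 1 with h' | h'
        · rcases hx.eq_or_lt with h0 | h0
          · have := Real.rpow_nonneg hx k
            linarith
          · refine e1.trans ?_
            have := Real.rpow_le_rpow_of_exponent_ge h0 h' hk1
            rwa [Real.rpow_one] at this
        · exact e2.trans (Real.one_le_rpow h'.le hk0.le)
      rw [Real.mul_rpow hz.le (by linarith)] at e3
      have e4 : z ^ k ≤ z ^ κ := Real.rpow_le_rpow_of_exponent_le h.le hkκ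
      have e5 : 0 ≤ z ^ k := Real.rpow_nonneg hz.le _
      rw [hWz]
      nlinarith [mul_le_mul_of_nonneg_right e4 hvk, mul_nonneg (by linarith : 0 ≤ -v) (e5.trans e4)]
  refine ⟨∫ z in Ioi (0:ℝ), W z ∂ν, k, ?_, hk0, hk1, ?_⟩
  · exact setIntegral_nonneg measurableSet_Ioi fun z hz => hW0 z hz
  intro v hv
  have hi : IntegrableOn (fun z => Real.exp (z * v) - 1) (Ioi 0) ν := by
    refine Integrable.mono' (hWi.const_mul ((-v) ^ k + (-v))) (by fun_prop) ?_
    filter_upwards [ae_restrict_mem measurableSet_Ioi] with z hz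
    have hz : 0 < z := hz
    have : Real.exp (z * v) ≤ 1 := Real.exp_le_one_iff.2 (by nlinarith)
    rw [Real.norm_eq_abs, abs_of_nonpos (by linarith)]
    linarith [hb z v hz hv]
  refine ⟨hi, ?_⟩
  rw [mul_comm, ← integral_const_mul, ← integral_neg]
  refine setIntegral_mono_on (hWi.const_mul _).neg hi measurableSet_Ioi fun z hz => ?_
  linarith [hb z v hz hv]

section psi
variable {b σ : ℝ}

lemma den_pos (hb : 0 < b) {t u : ℝ} (ht : 0 ≤ t) (hu : u ≤ 0) :
    1 ≤ 1 - σ ^ 2 * u / (2 * b) * (1 - Real.exp (-b * t)) := by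
  have : Real.exp (-b * t) ≤ 1 := Real.exp_le_one_iff.2 (by nlinarith)
  have h2 : σ ^ 2 * u / (2 * b) ≤ 0 :=
    div_nonpos_of_nonpos_of_nonneg (mul_nonpos_of_nonneg_of_nonpos (sq_nonneg _) hu) (by linarith)
  nlinarith

lemma psi_nonpos (hb : 0 < b) {t u : ℝ} (ht : 0 ≤ t) (hu : u ≤ 0) : psi b σ t u ≤ 0 := by
  unfold psi
  have := den_pos (σ := σ) hb ht hu
  exact div_nonpos_of_nonpos_of_nonneg
    (mul_nonpos_of_nonpos_of_nonneg hu (Real.exp_pos _).le) (by linarith)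

lemma psi_ge (hb : 0 < b) {t u : ℝ} (ht : 0 ≤ t) (hu : u ≤ 0) :
    -psi b σ t u ≤ -u * Real.exp (-b * t) := by
  unfold psi
  have := den_pos (σ := σ) hb ht hu
  rw [← neg_div, ← neg_mul]
  exact div_le_self (mul_nonneg (by linarith) (Real.exp_pos _).le) this

lemma psi_mono (hb : 0 < b) {s t u : ℝ} (hs : 0 ≤ s) (hst : s ≤ t) (hu : u ≤ 0) :
    psi b σ s u ≤ psi b σ t u := by
  have h1 := den_pos (σ := σ) hb hs hu
  have h2 := den_pos (σ := σ) hb (hs.trans hst) hu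
  have he : Real.exp (-b * t) ≤ Real.exp (-b * s) := Real.exp_le_exp.2 (by nlinarith)
  have h3 : σ ^ 2 * u / (2 * b) ≤ 0 :=
    div_nonpos_of_nonpos_of_nonneg (mul_nonpos_of_nonneg_of_nonpos (sq_nonneg _) hu) (by linarith)
  have : -psi b σ t u ≤ -psi b σ s u := by
    unfold psi
    rw [← neg_div, ← neg_mul, ← neg_div, ← neg_mul]
    apply div_le_div₀
    · exact mul_nonneg (by linarith) (Real.exp_pos _).le
    · exact mul_le_mul_of_nonneg_left he (by linarith)
    · linarith
    · nlinarith
  linarith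

lemma den_mul (hb : 0 < b) {s r u : ℝ} (hs : 0 ≤ s) (hu : u ≤ 0) :
    1 - σ ^ 2 * u / (2 * b) * (1 - Real.exp (-b * (s + r))) =
    (1 - σ ^ 2 * u / (2 * b) * (1 - Real.exp (-b * s))) *
    (1 - σ ^ 2 * psi b σ s u / (2 * b) * (1 - Real.exp (-b * r))) := by
  have h1 := den_pos (σ := σ) hb hs hu
  have h2 : psi b σ s u * (1 - σ ^ 2 * u / (2 * b) * (1 - Real.exp (-b * s))) =
    u * Real.exp (-b * s) := by
    unfold psi
    exact div_mul_cancel₀ _ (by linarith)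
  have h3 : Real.exp (-b * (s + r)) = Real.exp (-b * s) * Real.exp (-b * r) := by
    rw [← Real.exp_add]; congr 1; ring
  rw [h3]
  calc _ = (1 - σ ^ 2 * u / (2 * b) * (1 - Real.exp (-b * s))) - σ ^ 2 / (2 * b) *
      (u * Real.exp (-b * s)) * (1 - Real.exp (-b * r)) := by ring
    _ = _ := by rw [← h2]; ring

lemma psi_psi (hb : 0 < b) {s r u : ℝ} (hs : 0 ≤ s) (hr : 0 ≤ r) (hu : u ≤ 0) :
    psi b σ r (psi b σ s u) = psi b σ (s + r) u := by
  have h1 := den_pos (σ := σ) hb hs hu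
  have h2 := den_pos (σ := σ) hb hr (psi_nonpos (σ := σ) hb hs hu)
  have h3 : Real.exp (-b * (s + r)) = Real.exp (-b * s) * Real.exp (-b * r) := by
    rw [← Real.exp_add]; congr 1; ring
  have h4 := den_mul (σ := σ) (r := r) hb hs hu
  rw [psi, psi.eq_def b σ (s + r), h4, h3]
  rw [div_eq_div_iff (by linarith) (by nlinarith)]
  have h5 : psi b σ s u * (1 - σ ^ 2 * u / (2 * b) * (1 - Real.exp (-b * s))) =
    u * Real.exp (-b * s) := by
    unfold psi
    exact div_mul_cancel₀ _ (by linarith)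
  rw [← mul_assoc u, ← h5]; ring

lemma psi_form (hb : 0 < b) (hσ : 0 < σ) {s u : ℝ} (hs : 0 < s) (hu : u ≤ 0) :
    psi b σ s u = Real.exp (-b * s) / (σ ^ 2 / (2 * b) * (1 - Real.exp (-b * s))) *
      (1 / (1 - σ ^ 2 / (2 * b) * (1 - Real.exp (-b * s)) * u) - 1) := by
  have h1 := den_pos (σ := σ) hb hs.le hu
  have he : Real.exp (-b * s) < 1 := Real.exp_lt_one_iff.2 (by nlinarith)
  have h2 : 0 < σ ^ 2 / (2 * b) * (1 - Real.exp (-b * s)) :=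
    mul_pos (by positivity) (by linarith)
  unfold psi
  have h3 : σ ^ 2 * u / (2 * b) * (1 - Real.exp (-b * s)) =
    σ ^ 2 / (2 * b) * (1 - Real.exp (-b * s)) * u := by ring
  rw [h3] at h1 ⊢
  generalize σ ^ 2 / (2 * b) * (1 - Real.exp (-b * s)) = θ at *
  have : 1 - θ * u ≠ 0 := by linarith
  rw [show 1 / (1 - θ * u) - 1 = θ * u / (1 - θ * u) by rw [div_sub_one this]; ring]
  field_simp

end psi
section G
variable {b σ : ℝ} {F : ℝ → ℝ}

lemma G_int (hb : 0 < b) (hF : ∀ v w, v ≤ w → w ≤ 0 → F v ≤ F w) {u : ℝ} (hu : u ≤ 0) (t : ℝ) :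
    IntegrableOn (fun s => F (psi b σ s u)) (Ioc 0 t) := by
  have : MonotoneOn (fun s => F (psi b σ s u)) (Icc 0 t) := by
    intro x hx y hy hxy
    exact hF _ _ (psi_mono hb hx.1 hxy hu) (psi_nonpos hb hy.1 hu)
  exact (this.integrableOn_isCompact isCompact_Icc).mono_set Ioc_subset_Icc_self

lemma G_add (hb : 0 < b) (hF : ∀ v w, v ≤ w → w ≤ 0 → F v ≤ F w) {u : ℝ} (hu : u ≤ 0)
    {s r : ℝ} (hs : 0 ≤ s) (hr : 0 ≤ r) :
    ∫ x in Ioc 0 (s + r), F (psi b σ x u) =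
      (∫ x in Ioc 0 s, F (psi b σ x u)) + ∫ x in Ioc 0 r, F (psi b σ x (psi b σ s u)) := by
  have hsr : s ≤ s + r := by linarith
  have e : ∫ x in Ioc 0 r, F (psi b σ x (psi b σ s u)) = ∫ x in Ioc 0 r, F (psi b σ (x + s) u) := by
    refine setIntegral_congr_fun measurableSet_Ioc fun x hx => ?_
    rw [psi_psi hb hs hx.1.le hu, add_comm]
  rw [e, ← intervalIntegral.integral_of_le hr, ← intervalIntegral.integral_of_le hs,
    ← intervalIntegral.integral_of_le (hs.trans hsr),
    intervalIntegral.integral_comp_add_right (fun x => F (psi b σ x u)), zero_add, add_comm r s]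
  rw [intervalIntegral.integral_add_adjacent_intervals]
  · rw [intervalIntegrable_iff_integrableOn_Ioc_of_le hs]
    exact G_int hb hF hu s
  · rw [intervalIntegrable_iff_integrableOn_Ioc_of_le hsr]
    exact (G_int hb hF hu (s + r)).mono_set (Ioc_subset_Ioc_left hs)

lemma exp_int_le {c t : ℝ} (hc : 0 < c) : ∫ s in Ioc 0 t, Real.exp (-c * s) ≤ 1 / c := by
  have h := integral_exp_mul_Ioi (a := -c) (by linarith) 0
  have h2 : ∫ s in Ioc 0 t, Real.exp (-c * s) ≤ ∫ s in Ioi (0:ℝ), Real.exp (-c * s) := by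
    apply setIntegral_mono_set (integrableOn_exp_mul_Ioi (by linarith) 0)
    · exact Eventually.of_forall fun x => (Real.exp_pos _).le
    · exact Ioc_subset_Ioi_self.eventuallyLE
  rw [h] at h2
  simpa [neg_div_neg_eq] using h2

lemma G_ge (hb : 0 < b) (hF : ∀ v w, v ≤ w → w ≤ 0 → F v ≤ F w) {C k : ℝ} (hC : 0 ≤ C)
    (hk : 0 < k) (hFC : ∀ v ≤ 0, -(C * ((-v) ^ k + (-v))) ≤ F v) {u : ℝ} (hu : u ≤ 0) (t : ℝ) :
    -(C * ((-u) ^ k * (1 / (b * k)) + (-u) * (1 / b))) ≤ ∫ x in Ioc 0 t, F (psi b σ x u) := by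
  have hbk : 0 < b * k := mul_pos hb hk
  have hi : ∀ c : ℝ, 0 < c → IntegrableOn (fun s => Real.exp (-c * s)) (Ioc 0 t) := fun c hc =>
    (integrableOn_exp_mul_Ioi (by linarith) 0).mono_set Ioc_subset_Ioi_self
  have h1 : ∀ x ∈ Ioc 0 t, -(C * ((-u) ^ k * Real.exp (-(b * k) * x) +
      (-u) * Real.exp (-b * x))) ≤ F (psi b σ x u) := by
    intro x hx
    have hp := psi_nonpos (σ := σ) hb hx.1.le hu
    refine le_trans ?_ (hFC _ hp)
    have h2 := psi_ge (σ := σ) hb hx.1.le hu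
    have h3 : (-psi b σ x u) ^ k ≤ (-u) ^ k * Real.exp (-(b * k) * x) := by
      calc (-psi b σ x u) ^ k ≤ (-u * Real.exp (-b * x)) ^ k :=
            Real.rpow_le_rpow (by linarith) h2 hk.le
        _ = _ := by
            rw [Real.mul_rpow (by linarith) (Real.exp_pos _).le, ← Real.exp_mul]
            congr 2; ring
    apply neg_le_neg
    gcongr
  have h4 : IntegrableOn (fun x => -(C * ((-u) ^ k * Real.exp (-(b * k) * x) +
      (-u) * Real.exp (-b * x)))) (Ioc 0 t) :=
    ((((hi _ hbk).const_mul _).add ((hi _ hb).const_mul _)).const_mul _).neg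
  refine le_trans ?_ (setIntegral_mono_on h4 (G_int hb hF hu t) measurableSet_Ioc h1)
  rw [integral_neg, integral_const_mul, integral_add ((hi _ hbk).const_mul _)
    ((hi _ hb).const_mul _), integral_const_mul, integral_const_mul]
  have h5 : 0 ≤ (-u) ^ k := Real.rpow_nonneg (by linarith) _
  have h6 : 0 ≤ -u := by linarith
  apply neg_le_neg
  have := exp_int_le (t := t) hbk
  have := exp_int_le (t := t) hb
  gcongr
end G

lemma gamma_ge {α y : ℝ} (hα : 0 ≤ α) (hy : 0 ≤ y) : Real.exp (-(α * y)) ≤ (1 + y) ^ (-α) := by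
  rw [show -(α * y) = y * (-α) by ring, Real.exp_mul]
  apply Real.rpow_le_rpow_of_nonpos (by linarith)
  · linarith [Real.add_one_le_exp y]
  · linarith
theorem jcir_exponentially_ergodic (a b σ κ : ℝ) (ha : 0 < a) (hb : 0 < b) (hσ : 0 < σ)
    (hκ : 0 < κ)
    (ν : Measure ℝ) (hνsupp : ν (Set.Iic 0) = 0)
    (hν : ∫⁻ z in Set.Ioi (0 : ℝ), ENNReal.ofReal (min z 1) ∂ν < ⊤)
    (hνκ : ∫⁻ z in Set.Ioi (1 : ℝ), ENNReal.ofReal (z ^ κ) ∂ν < ⊤)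
    (μ : ℝ → ℝ → Measure ℝ)
    (hμ : ∀ t x : ℝ, 0 ≤ t → 0 ≤ x → IsProbabilityMeasure (μ t x))
    (hμsupp : ∀ t x : ℝ, 0 ≤ t → 0 ≤ x → μ t x (Set.Iio 0) = 0)
    (hLap : ∀ t x : ℝ, 0 ≤ t → 0 ≤ x → ∀ u : ℝ, u ≤ 0 →
      ∫ y, Real.exp (u * y) ∂(μ t x) =
        (1 - σ ^ 2 * u / (2 * b) * (1 - Real.exp (-b * t))) ^ (-(2 * a / σ ^ 2)) *
          Real.exp (x * psi b σ t u) *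
          Real.exp (∫ s in Set.Ioc (0 : ℝ) t,
            ∫ z in Set.Ioi (0 : ℝ), (Real.exp (z * psi b σ s u) - 1) ∂ν)) :
    ∃ π : Measure ℝ, IsProbabilityMeasure π ∧
      ∃ δ : ℝ, 0 < δ ∧ ∃ B : ℝ → ℝ, (∀ x : ℝ, 0 ≤ B x) ∧
        ∀ x t : ℝ, 0 ≤ x → 0 < t →
          tvDist (μ t x) π ≤ ENNReal.ofReal (B x * Real.exp (-δ * t)) := by
  obtain ⟨C, k, hC, hk, hk1, hFp⟩ := F_props ν κ hκ hν hνκ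
  set F : ℝ → ℝ := fun v => ∫ z in Set.Ioi (0 : ℝ), (Real.exp (z * v) - 1) ∂ν with hFdef
  have hFmono : ∀ v w, v ≤ w → w ≤ 0 → F v ≤ F w := by
    intro v w hvw hw
    refine setIntegral_mono_on (hFp v (hvw.trans hw)).1 (hFp w hw).1 measurableSet_Ioi fun z hz => ?_
    have hz : 0 < z := hz
    have : Real.exp (z * v) ≤ Real.exp (z * w) := Real.exp_le_exp.2 (by nlinarith)
    linarith
  have hFC : ∀ v ≤ 0, -(C * ((-v) ^ k + (-v))) ≤ F v := fun v hv => (hFp v hv).2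
  set α := 2 * a / σ ^ 2 with hα
  have hα0 : 0 < α := by positivity
  set c := σ ^ 2 / (2 * b) with hc
  have hc0 : 0 < c := by positivity
  have hae : ∀ t x, 0 ≤ t → 0 ≤ x → ∀ᵐ y ∂(μ t x), 0 ≤ y := by
    intro t x ht hx
    rw [ae_iff]
    have : {y : ℝ | ¬ 0 ≤ y} = Iio 0 := by ext y; simp
    rw [this]; exact hμsupp t x ht hx
  set H : ℝ → ℝ → ℝ := fun t u => (1 - σ ^ 2 * u / (2 * b) * (1 - Real.exp (-b * t))) ^ (-α) *
    Real.exp (∫ s in Ioc 0 t, F (psi b σ s u)) with hH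
  have hH0 : ∀ t u, 0 ≤ t → u ≤ 0 → 0 ≤ H t u := fun t u ht hu =>
    mul_nonneg (Real.rpow_nonneg (by linarith [den_pos (σ := σ) hb ht hu]) _) (Real.exp_pos _).le
  have hl : ∀ t x u, 0 ≤ t → 0 ≤ x → u ≤ 0 →
      lapl (μ t x) u = ENNReal.ofReal (H t u * Real.exp (x * psi b σ t u)) := by
    intro t x u ht hx hu
    have := hμ t x ht hx
    unfold lapl
    rw [← ofReal_integral_eq_lintegral_ofReal]
    · rw [hLap t x ht hx u hu]
      congr 1
      simp only [hH]; ring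
    · refine Integrable.mono' (integrable_const (1:ℝ)) (by fun_prop) ?_
      filter_upwards [hae t x ht hx] with y hy
      rw [Real.norm_eq_abs, abs_of_pos (Real.exp_pos _), Real.exp_le_one_iff]
      nlinarith
    · exact Eventually.of_forall fun y => (Real.exp_pos _).le
  set θ : ℝ → ℝ := fun s => c * (1 - Real.exp (-b * s)) with hθ
  have hθ0 : ∀ s, 0 < s → 0 < θ s := by
    intro s hs
    have : Real.exp (-b * s) < 1 := Real.exp_lt_one_iff.2 (by nlinarith)
    exact mul_pos hc0 (by linarith)
  set l : ℝ → ℝ := fun s => Real.exp (-b * s) / θ s with hldef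
  have hl0 : ∀ s, 0 < s → 0 < l s := fun s hs => div_pos (Real.exp_pos _) (hθ0 s hs)
  have hpsi : ∀ s u, 0 < s → u ≤ 0 → l s * (1 / (1 - θ s * u) - 1) = psi b σ s u :=
    fun s u hs hu => (psi_form hb hσ hs hu).symm
  have dom1 : ∀ t x, 0 < t → 0 ≤ x →
      ENNReal.ofReal (Real.exp (-(l t * x))) • μ t 0 ≤ μ t x := by
    intro t x ht hx
    have := hμ t 0 ht.le le_rfl
    have := hμ t x ht.le hx
    have hd : ∀ v, lapl (Measure.dirac x) v = ENNReal.ofReal (Real.exp (v * x)) := by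
      intro v; simp [lapl]
    have := domination (μ t 0) (Measure.dirac x) (μ t x) (hae t 0 ht.le le_rfl)
      (by rw [ae_dirac_iff measurableSet_Ici]; exact hx) (hae t x ht.le hx) (l t) (θ t) (hl0 t ht)
      (hθ0 t ht) ?_
    · rwa [hd, neg_mul] at this
    · intro u hu
      rw [hpsi t u ht hu, hd, hl t x u ht.le hx hu, hl t 0 u ht.le le_rfl hu,
        ← ENNReal.ofReal_mul (mul_nonneg (hH0 t u ht.le hu) (Real.exp_pos _).le)]
      simp [mul_comm]
  have dom2 : ∀ s r, 0 < s → 0 ≤ r →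
      ENNReal.ofReal (H r (-l s)) • μ s 0 ≤ μ (s + r) 0 := by
    intro s r hs hr
    have hsr : 0 ≤ s + r := by linarith
    have := hμ s 0 hs.le le_rfl
    have := hμ (s + r) 0 hsr le_rfl
    have := domination (μ s 0) (μ r 0) (μ (s + r) 0) (hae s 0 hs.le le_rfl)
      (hae r 0 hr le_rfl) (hae _ 0 hsr le_rfl) (l s) (θ s) (hl0 s hs) (hθ0 s hs) ?_
    · rw [hl r 0 _ hr le_rfl (by linarith [hl0 s hs])] at this
      simpa using this
    · intro u hu
      have hp := psi_nonpos (σ := σ) hb hs.le hu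
      rw [hpsi s u hs hu, hl _ 0 u hsr le_rfl hu, hl s 0 u hs.le le_rfl hu, hl r 0 _ hr le_rfl hp,
        ← ENNReal.ofReal_mul (mul_nonneg (hH0 s u hs.le hu) (Real.exp_pos _).le)]
      congr 1
      simp only [zero_mul, Real.exp_zero, mul_one, hH]
      rw [G_add hb hFmono hu hs.le hr, Real.exp_add, den_mul hb hs.le hu,
        Real.mul_rpow (by linarith [den_pos (σ := σ) hb hs.le hu])
          (by linarith [den_pos (σ := σ) hb hr hp])]
      ring
  set K := 1 / θ 1 with hK
  have hK0 : 0 < K := by have := hθ0 1 one_pos; positivity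
  have hlK : ∀ s, 1 ≤ s → l s ≤ K * Real.exp (-b * s) := by
    intro s hs
    have h1 : θ 1 ≤ θ s := by
      simp only [hθ]
      have : Real.exp (-b * s) ≤ Real.exp (-b * 1) := Real.exp_le_exp.2 (by nlinarith)
      exact mul_le_mul_of_nonneg_left (by linarith) hc0.le
    simp only [hldef, hK]
    rw [one_div_mul_eq_div]
    exact div_le_div_of_nonneg_left (Real.exp_pos _).le (hθ0 1 one_pos) h1
  set δ := b * k with hδ
  have hδ0 : 0 < δ := mul_pos hb hk
  have hed : ∀ s, 0 ≤ s → Real.exp (-b * s) ≤ Real.exp (-δ * s) := by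
    intro s hs
    apply Real.exp_le_exp.2
    have : δ ≤ b := by rw [hδ]; nlinarith
    nlinarith
  set D := α * c * K + C * (K ^ k * (1 / (b * k)) + K * (1 / b)) with hD
  have hKk : 0 ≤ K ^ k := Real.rpow_nonneg hK0.le _
  have hD0 : 0 ≤ D := by positivity
  have hHD : ∀ s r, 1 ≤ s → 0 ≤ r → Real.exp (-(D * Real.exp (-δ * s))) ≤ H r (-l s) := by
    intro s r hs hr
    have hs0 : 0 < s := by linarith
    have hls := hl0 s hs0
    have hlk := hlK s hs
    have hE := Real.exp_pos (-δ * s)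
    have hll : l s ≤ K * Real.exp (-δ * s) :=
      hlk.trans (mul_le_mul_of_nonneg_left (hed s hs0.le) hK0.le)
    have hlpow : (l s) ^ k ≤ K ^ k * Real.exp (-δ * s) := by
      calc (l s) ^ k ≤ (K * Real.exp (-b * s)) ^ k := Real.rpow_le_rpow hls.le hlk hk.le
        _ = _ := by
          rw [Real.mul_rpow hK0.le (Real.exp_pos _).le, ← Real.exp_mul]
          congr 2; rw [hδ]; ring
    have h1 := G_ge (σ := σ) hb hFmono hC hk hFC (u := -l s) (by linarith) r
    rw [neg_neg] at h1
    have her : Real.exp (-b * r) ≤ 1 := Real.exp_le_one_iff.2 (by nlinarith)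
    have her0 := Real.exp_pos (-b * r)
    have h2 := gamma_ge hα0.le (y := c * l s * (1 - Real.exp (-b * r)))
      (mul_nonneg (by positivity) (by linarith))
    have h3 : 1 - σ ^ 2 * (-l s) / (2 * b) * (1 - Real.exp (-b * r)) =
        1 + c * l s * (1 - Real.exp (-b * r)) := by rw [hc]; ring
    simp only [hH]
    rw [h3]
    calc Real.exp (-(D * Real.exp (-δ * s)))
        ≤ Real.exp (-(α * (c * l s * (1 - Real.exp (-b * r)))) +
          -(C * ((l s) ^ k * (1 / (b * k)) + l s * (1 / b)))) := by
          apply Real.exp_le_exp.2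
          have e1 : α * (c * l s * (1 - Real.exp (-b * r))) ≤
              α * (c * (K * Real.exp (-δ * s)) * 1) := by
            gcongr
            linarith
          have e2 : C * ((l s) ^ k * (1 / (b * k)) + l s * (1 / b)) ≤
            C * ((K ^ k * Real.exp (-δ * s)) * (1 / (b * k)) + (K * Real.exp (-δ * s)) * (1 / b)) := by
            gcongr
          have e3 : D * Real.exp (-δ * s) = α * (c * (K * Real.exp (-δ * s)) * 1) +
            C * ((K ^ k * Real.exp (-δ * s)) * (1 / (b * k)) + (K * Real.exp (-δ * s)) * (1 / b)) := by
            rw [hD]; ring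
          linarith
      _ = _ := Real.exp_add _ _
      _ ≤ _ := by
        apply mul_le_mul h2 (Real.exp_le_exp.2 h1) (Real.exp_pos _).le
        exact Real.rpow_nonneg (by
          have : 0 ≤ c * l s * (1 - Real.exp (-b * r)) := mul_nonneg (by positivity) (by linarith)
          linarith) _
  obtain ⟨π, hπ, hπle⟩ := exists_limit (fun t => μ t 0) (fun t ht => hμ t 0 (by linarith) le_rfl)
    D δ hδ0 (by
      intro s r hs hr
      refine le_trans ?_ (dom2 s r (by linarith) hr)
      have := ENNReal.ofReal_le_ofReal (hHD s r hs hr)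
      rw [Measure.le_iff]
      intro A hA
      simp only [Measure.smul_apply, smul_eq_mul]
      gcongr)
  refine ⟨π, hπ, δ, hδ0, fun x => 2 * (D + |x| * K) + 2 * Real.exp δ, fun x => by positivity, ?_⟩
  intro x t hx ht
  have hp1 := hμ t x ht.le hx
  have hp0 := hμ t 0 ht.le le_rfl
  rcases lt_or_ge t 1 with h1 | h1
  · have hz : tvDist (μ t x) π ≤ 2 := by
      have := tv_le (μ t x) π 0 (Measure.zero_le _) (Measure.zero_le _)
      simpa using this
    refine hz.trans ?_
    rw [show (2:ℝ≥0∞) = ENNReal.ofReal 2 by simp]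
    apply ENNReal.ofReal_le_ofReal
    have e : 1 ≤ Real.exp δ * Real.exp (-δ * t) := by
      rw [← Real.exp_add]; apply Real.one_le_exp; nlinarith
    have : 0 ≤ (D + |x| * K) * Real.exp (-δ * t) := by positivity
    nlinarith
  · set q := D * Real.exp (-δ * t) + l t * x with hq
    have hlt := hl0 t ht
    have hE := Real.exp_pos (-δ * t)
    set η : Measure ℝ := ENNReal.ofReal (Real.exp (-q)) • μ t 0 with hη
    have hle1 : η ≤ μ t x := by
      refine le_trans ?_ (dom1 t x ht hx)
      have : ENNReal.ofReal (Real.exp (-q)) ≤ ENNReal.ofReal (Real.exp (-(l t * x))) := by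
        apply ENNReal.ofReal_le_ofReal; apply Real.exp_le_exp.2
        have : 0 ≤ D * Real.exp (-δ * t) := by positivity
        rw [hq]; linarith
      rw [Measure.le_iff]
      intro A hA
      simp only [hη, Measure.smul_apply, smul_eq_mul]
      gcongr
    have hle2 : η ≤ π := by
      refine le_trans ?_ (hπle t h1)
      have : ENNReal.ofReal (Real.exp (-q)) ≤
          ENNReal.ofReal (Real.exp (-(D * Real.exp (-δ * t)))) := by
        apply ENNReal.ofReal_le_ofReal; apply Real.exp_le_exp.2
        have : 0 ≤ l t * x := by positivity
        rw [hq]; linarith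
      rw [Measure.le_iff]
      intro A hA
      simp only [hη, Measure.smul_apply, smul_eq_mul]
      gcongr
    have hηf : IsFiniteMeasure η := Measure.smul_finite _ ENNReal.ofReal_ne_top
    refine (tv_le (μ t x) π η hle1 hle2).trans ?_
    have e1 : η univ = ENNReal.ofReal (Real.exp (-q)) := by simp [hη]
    rw [e1, show (2:ℝ≥0∞) = ENNReal.ofReal 2 by simp, ← ENNReal.ofReal_one,
      ← ENNReal.ofReal_sub _ (Real.exp_pos _).le, ← ENNReal.ofReal_mul (by norm_num)]
    apply ENNReal.ofReal_le_ofReal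
    have e2 : 1 - Real.exp (-q) ≤ q := by linarith [Real.add_one_le_exp (-q)]
    have e3 : l t * x ≤ |x| * K * Real.exp (-δ * t) := by
      have := (hlK t h1).trans (mul_le_mul_of_nonneg_left (hed t ht.le) hK0.le)
      rw [abs_of_nonneg hx]
      calc l t * x ≤ K * Real.exp (-δ * t) * x := mul_le_mul_of_nonneg_right this hx
        _ = _ := by ring
    have e4 : 0 ≤ Real.exp δ * Real.exp (-δ * t) := by positivity
    have : q ≤ (D + |x| * K) * Real.exp (-δ * t) := by rw [hq]; linarith
    linarith
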